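/- There is no stable 3-pair network N with pairwise distinct indices i, j, l ∈ {1,2,3} such that both: (1) m_{i,j}^i = {l}, m_{i,j}^j = {i}, m_{i,l}^i = {l}, m_{i,l}^l = {j}, m_{j,l}^j = {i}, and m_{j,l}^l = {j}; and (2) there exists an l.c.s. of the three paths {P_{s_j,t_i}, P_{s_l,t_j}, P_{s_i,t_l}}. -/

import Mathlib

open scoped BigOperators

/-- A `k`-pair network: a finite DAG with `k` sources of in-degree 0 and
`k` sinks of out-degree 0. -/
structure KPairNetwork (k : ℕ) where
  V : Type
  A : Type
  [fintypeV : Fintype V]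
  [fintypeA : Fintype A]
  [decEqV : DecidableEq V]
  [decEqA : DecidableEq A]
  tail : A → V
  head : A → V
  /-- acyclicity, via a topological ordering of the vertices -/
  acyclic : ∃ ord : V → ℕ, ∀ a : A, ord (tail a) < ord (head a)
  src : Fin k → V
  snk : Fin k → V
  src_inj : Function.Injective src
  snk_inj : Function.Injective snk
  src_no_in : ∀ (i : Fin k) (a : A), head a ≠ src i
  snk_no_out : ∀ (i : Fin k) (a : A), tail a ≠ snk i

attribute [instance] KPairNetwork.fintypeV KPairNetwork.fintypeA
attribute [instance] KPairNetwork.decEqV KPairNetwork.decEqA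

namespace KPairNetwork

variable {k : ℕ} (N : KPairNetwork k)

/-- `l` is (the list of arcs of) a directed path from `u` to `v`. -/
def IsPathFrom (u v : N.V) (l : List N.A) : Prop :=
  l ≠ [] ∧ l.Chain' (fun a b => N.head a = N.tail b) ∧
    (∀ a ∈ l.head?, N.tail a = u) ∧ (∀ a ∈ l.getLast?, N.head a = v)

/-- The vertices lying on a (nonempty) list of arcs. -/
def pathVerts (l : List N.A) : Set N.V :=
  {v | ∃ a ∈ l, v = N.tail a ∨ v = N.head a}

/-- `P i j` is a path from `s i` to `t j`, and for each sink `j` the `k`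
paths `P · j` are pairwise arc-disjoint (strong reachability). -/
def IsStrongSystem (P : Fin k → Fin k → List N.A) : Prop :=
  (∀ i j, N.IsPathFrom (N.src i) (N.snk j) (P i j)) ∧
    ∀ (j i i' : Fin k), i ≠ i' → ∀ a : N.A, a ∈ P i j → a ∉ P i' j

/-- Extra strong reachability: in addition, for each sink `j`, two distinct
paths towards `t j` share no vertex other than `t j`. -/
def IsExtraStrongSystem (P : Fin k → Fin k → List N.A) : Prop :=
  N.IsStrongSystem P ∧
    ∀ (j i i' : Fin k), i ≠ i' →
      ∀ v : N.V, v ∈ N.pathVerts (P i j) → v ∈ N.pathVerts (P i' j) → v = N.snk j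

/-- Stability: the choice of the `k` pairwise arc-disjoint paths towards each
sink is unique. -/
def IsStableSystem (P : Fin k → Fin k → List N.A) : Prop :=
  N.IsStrongSystem P ∧
    ∀ (j : Fin k) (Q : Fin k → List N.A),
      (∀ i, N.IsPathFrom (N.src i) (N.snk j) (Q i)) →
      (∀ i i', i ≠ i' → ∀ a : N.A, a ∈ Q i → a ∉ Q i') →
      ∀ i, Q i = P i j

/-- `excess_f(v) = Σ_{head a = v} f a − Σ_{tail a = v} f a`. -/
noncomputable def excess (f : N.A → ℝ) (v : N.V) : ℝ :=
  (∑ a : N.A, if N.head a = v then f a else 0) -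
    (∑ a : N.A, if N.tail a = v then f a else 0)

/-- An `u`–`v` flow: zero excess away from `u` and `v`. -/
def IsFlow (u v : N.V) (f : N.A → ℝ) : Prop :=
  ∀ w : N.V, w ≠ u → w ≠ v → N.excess f w = 0

/-- The unit flow along a path: `1` on its arcs and `0` elsewhere. -/
noncomputable def unitFlow (l : List N.A) : N.A → ℝ :=
  fun a => if a ∈ l then 1 else 0

/-- The set of source/sink index pairs whose path passes through the arc `a`. -/
def arcPattern (P : Fin k → Fin k → List N.A) (a : N.A) : Finset (Fin k × Fin k) :=
  Finset.univ.filter (fun q => a ∈ P q.1 q.2)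

/-- `S_N`, the family of index-pair patterns of the arcs of `N`. -/
def SN (P : Fin k → Fin k → List N.A) : Set (Finset (Fin k × Fin k)) :=
  {T | ∃ a : N.A, T = N.arcPattern P a}

/-! ### Segments and longest common segments -/

/-- A segment: a start vertex together with a (possibly empty) chained list of
arcs starting there.  A segment with no arcs is a single vertex. -/
def IsSeg (s : N.V × List N.A) : Prop :=
  s.2.Chain' (fun a b => N.head a = N.tail b) ∧ ∀ a ∈ s.2.head?, N.tail a = s.1

/-- The vertices of a segment. -/
def segVerts (s : N.V × List N.A) : Set N.V :=
  insert s.1 (N.pathVerts s.2)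

/-- The final vertex of a segment. -/
def segEnd (s : N.V × List N.A) : N.V :=
  s.2.getLast?.elim s.1 N.head

/-- The segment `s` lies on the path `p`. -/
def SegOn (s : N.V × List N.A) (p : List N.A) : Prop :=
  s.2 <:+: p ∧ s.1 ∈ N.pathVerts p

/-- The segment `s` is contained in the segment `s'`. -/
def SegLE (s s' : N.V × List N.A) : Prop :=
  s.2 <:+: s'.2 ∧ s.1 ∈ N.segVerts s'

/-- `s` is a longest common segment (l.c.s.) of the set of paths `ps`:
it is a segment common to all paths of `ps`, and no segment properly
containing it is common to all paths of `ps`. -/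
def IsLCS (ps : Set (List N.A)) (s : N.V × List N.A) : Prop :=
  N.IsSeg s ∧ (∀ p ∈ ps, N.SegOn s p) ∧
    ∀ s' : N.V × List N.A, N.IsSeg s' → N.SegLE s s' → s' ≠ s →
      ∃ p ∈ ps, ¬ N.SegOn s' p

/-- `s` is an l.c.s. of some pair `{P i j₁, P i' j₂}` and lies on `p`. -/
def IsPairLCSOn (P : Fin k → Fin k → List N.A) (j₁ j₂ : Fin k)
    (p : List N.A) (s : N.V × List N.A) : Prop :=
  (∃ i i' : Fin k, N.IsLCS {P i j₁, P i' j₂} s) ∧ N.SegOn s p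

/-- `ℓ^{j₁,j₂}(p)`: the number of l.c.s.'s of pairs `{P i j₁, P i' j₂}` lying
on the path `p`. -/
noncomputable def lcsCount (P : Fin k → Fin k → List N.A) (j₁ j₂ : Fin k)
    (p : List N.A) : ℕ :=
  Nat.card {s : N.V × List N.A | N.IsPairLCSOn P j₁ j₂ p s}

/-- `m_{j₁,j₂}^c = {i : ℓ^{j₁,j₂}(P_{s_i,t_c}) = 1}`. -/
def mset (P : Fin k → Fin k → List N.A) (j₁ j₂ c : Fin k) : Set (Fin k) :=
  {i | N.lcsCount P j₁ j₂ (P i c) = 1}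

/-- `u` lies strictly before `v` along the path `p` (there is a nonempty
infix of `p` going from `u` to `v`). -/
def StrictlyBeforeOn (p : List N.A) (u v : N.V) : Prop :=
  ∃ l : List N.A, l <:+: p ∧ l.head?.map N.tail = some u ∧ l.getLast?.map N.head = some v

/-- `e 0, …, e (L-1)` enumerates, in the order along `p`, the l.c.s.'s
`p(1) < p(2) < ⋯ < p(L)` of pairs `{P i j₁, P i' j₂}` lying on `p`. -/
def IsLCSEnum (P : Fin k → Fin k → List N.A) (j₁ j₂ : Fin k) (p : List N.A)
    (e : ℕ → N.V × List N.A) (L : ℕ) : Prop :=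
  (∀ n, n < L → N.IsPairLCSOn P j₁ j₂ p (e n)) ∧
  (∀ s, N.IsPairLCSOn P j₁ j₂ p s → ∃ n, n < L ∧ e n = s) ∧
  (∀ m n, m < n → n < L → N.StrictlyBeforeOn p (N.segEnd (e m)) (e n).1)

/-! ### Residual networks, regular cycles, semi-cycles and crossings -/

/-- `a` is a `P_{t_j}`-arc. -/
def isPArc (P : Fin k → Fin k → List N.A) (j : Fin k) (a : N.A) : Prop :=
  ∃ i, a ∈ P i j

/-- The tail of `a` in the `j`-th residual network `N_j` (in which all
`P_{t_j}`-arcs are reversed). -/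
def rtail (P : Fin k → Fin k → List N.A) (j : Fin k) (a : N.A) : N.V :=
  if ∃ i, a ∈ P i j then N.head a else N.tail a

/-- The head of `a` in the `j`-th residual network `N_j`. -/
def rhead (P : Fin k → Fin k → List N.A) (j : Fin k) (a : N.A) : N.V :=
  if ∃ i, a ∈ P i j then N.tail a else N.head a

/-- `l` is a directed cycle of the residual network `N_j`. -/
def IsResidCycle (P : Fin k → Fin k → List N.A) (j : Fin k) (l : List N.A) : Prop :=
  l ≠ [] ∧ l.Nodup ∧
  l.Chain' (fun a b => N.rhead P j a = N.rtail P j b) ∧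
  (∀ a ∈ l.getLast?, ∀ b ∈ l.head?, N.rhead P j a = N.rtail P j b) ∧
  (l.map (N.rtail P j)).Nodup

/-- A regular cycle of `N_j`: a directed cycle of `N_j` having no isolated
vertex of `P_{t_j}`, i.e. every vertex of the cycle lying on a path of
`P_{t_j}` is incident in the cycle to some (reversed) `P_{t_j}`-arc. -/
def IsRegularCycle (P : Fin k → Fin k → List N.A) (j : Fin k) (l : List N.A) : Prop :=
  N.IsResidCycle P j l ∧
    ∀ v ∈ l.map (N.rtail P j),
      (∃ i, v ∈ N.pathVerts (P i j)) →
      ∃ a ∈ l, N.isPArc P j a ∧ (v = N.tail a ∨ v = N.head a)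

/-- A `P_{t_j}`-semi-cycle of `N`: the arc set of a regular cycle of `N_j`,
with the original orientations of `N` restored. -/
def IsSemiCycle (P : Fin k → Fin k → List N.A) (j : Fin k) (E : Set N.A) : Prop :=
  ∃ l : List N.A, N.IsRegularCycle P j l ∧ E = {a | a ∈ l}

/-- A `P_{t_j}`-crossing of `N`: a `P_{t_j}`-semi-cycle with all its
`P_{t_j}`-arcs removed. -/
def IsCrossing (P : Fin k → Fin k → List N.A) (j : Fin k) (E : Set N.A) : Prop :=
  ∃ l : List N.A, N.IsRegularCycle P j l ∧ E = {a | a ∈ l ∧ ¬ N.isPArc P j a}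

end KPairNetwork

namespace KPairNetwork

variable {k : ℕ} {N : KPairNetwork k}

/-! ### Walks -/

/-- `l` is the (possibly empty) list of arcs of a directed walk from `u` to `v`. -/
def IsWalk (N : KPairNetwork k) : N.V → N.V → List N.A → Prop
  | u, v, [] => u = v
  | u, v, a :: l => N.tail a = u ∧ IsWalk N (N.head a) v l

theorem isPathFrom_iff {u v : N.V} {l : List N.A} :
    N.IsPathFrom u v l ↔ l ≠ [] ∧ N.IsWalk u v l := by
  induction l generalizing u with
  | nil => simp [IsPathFrom]
  | cons a l ih =>
    cases l with
    | nil => simp [IsPathFrom, IsWalk, List.Chain']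
    | cons b l =>
      have := @ih (N.head a)
      simp only [IsPathFrom, List.Chain', IsWalk, ne_eq, reduceCtorEq, not_false_eq_true,
        List.isChain_cons_cons, List.head?_cons, Option.mem_def, Option.some.injEq,
        forall_eq', List.getLast?_cons_cons, true_and] at this ⊢
      grind

theorem IsWalk.append {u v w : N.V} {l₁ l₂ : List N.A} (h₁ : N.IsWalk u v l₁)
    (h₂ : N.IsWalk v w l₂) : N.IsWalk u w (l₁ ++ l₂) := by
  induction l₁ generalizing u with
  | nil => cases h₁; exact h₂
  | cons a l ih => exact ⟨h₁.1, ih h₁.2⟩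

theorem IsWalk.exists_append {u v x : N.V} {l : List N.A} (h : N.IsWalk u v l)
    (hx : x ∈ N.pathVerts l) :
    ∃ l₁ l₂, l = l₁ ++ l₂ ∧ N.IsWalk u x l₁ ∧ N.IsWalk x v l₂ := by
  induction l generalizing u with
  | nil => obtain ⟨a, ha, -⟩ := hx; simp at ha
  | cons a l ih =>
    by_cases hu : x = u
    · exact ⟨[], a :: l, rfl, hu.symm, hu ▸ h⟩
    by_cases hh : x = N.head a
    · exact ⟨[a], l, rfl, ⟨h.1, hh.symm⟩, hh ▸ h.2⟩
    · have hx' : x ∈ N.pathVerts l := by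
        obtain ⟨b, hb, hb'⟩ := hx
        rcases List.mem_cons.1 hb with rfl | hb
        · rcases hb' with hb' | hb'
          · exact absurd (hb'.trans h.1) hu
          · exact absurd hb' hh
        · exact ⟨b, hb, hb'⟩
      obtain ⟨l₁, l₂, rfl, h₁, h₂⟩ := ih h.2 hx'
      exact ⟨a :: l₁, l₂, rfl, ⟨h.1, h₁⟩, h₂⟩

theorem IsWalk.isSeg {u v : N.V} {l : List N.A} (h : N.IsWalk u v l) : N.IsSeg (u, l) := by
  by_cases hl : l = []
  · subst hl; simp [IsSeg, List.Chain']
  · have := isPathFrom_iff.2 ⟨hl, h⟩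
    exact ⟨this.2.1, this.2.2.1⟩

theorem tail_mem_pathVerts {l : List N.A} {e : N.A} (he : e ∈ l) : N.tail e ∈ N.pathVerts l :=
  ⟨e, he, Or.inl rfl⟩

theorem head_mem_pathVerts {l : List N.A} {e : N.A} (he : e ∈ l) : N.head e ∈ N.pathVerts l :=
  ⟨e, he, Or.inr rfl⟩

theorem pathVerts_mono {l l' : List N.A} (h : l ⊆ l') : N.pathVerts l ⊆ N.pathVerts l' :=
  fun _ ⟨e, he, hx⟩ => ⟨e, h he, hx⟩

theorem IsWalk.eq_or_exists_tail {u v x : N.V} {l : List N.A} (h : N.IsWalk u v l)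
    (hx : x ∈ N.pathVerts l) : x = v ∨ ∃ e ∈ l, N.tail e = x := by
  obtain ⟨l₁, l₂, rfl, -, h₂⟩ := h.exists_append hx
  cases l₂ with
  | nil => exact Or.inl h₂
  | cons e l => exact Or.inr ⟨e, by simp, h₂.1⟩

theorem IsWalk.eq_or_exists_head {u v x : N.V} {l : List N.A} (h : N.IsWalk u v l)
    (hx : x ∈ N.pathVerts l) : x = u ∨ ∃ e ∈ l, N.head e = x := by
  induction l generalizing u with
  | nil => obtain ⟨a, ha, -⟩ := hx; simp at ha
  | cons a l ih =>
    obtain ⟨b, hb, hb'⟩ := hx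
    rcases List.mem_cons.1 hb with rfl | hb
    · rcases hb' with hb' | hb'
      · exact Or.inl (hb'.trans h.1)
      · exact Or.inr ⟨b, by simp, hb'.symm⟩
    · rcases ih h.2 ⟨b, hb, hb'⟩ with h' | ⟨e, he, he'⟩
      · exact Or.inr ⟨a, by simp, h'.symm⟩
      · exact Or.inr ⟨e, by simp [he], he'⟩

section Order

variable {ord : N.V → ℕ} (hord : ∀ a : N.A, ord (N.tail a) < ord (N.head a))
include hord

theorem IsWalk.ord_le {u v : N.V} {l : List N.A} (h : N.IsWalk u v l) : ord u ≤ ord v := by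
  induction l generalizing u with
  | nil => exact (congrArg ord h).le
  | cons a l ih =>
    have := ih h.2
    have := hord a
    rw [h.1] at this
    omega

theorem IsWalk.ord_le_tail {u v : N.V} {l : List N.A} (h : N.IsWalk u v l) {e : N.A}
    (he : e ∈ l) : ord u ≤ ord (N.tail e) := by
  induction l generalizing u with
  | nil => simp at he
  | cons a l ih =>
    rcases List.mem_cons.1 he with rfl | he
    · rw [h.1]
    · have := ih h.2 he
      have := hord a
      rw [h.1] at this
      omega

theorem IsWalk.head_ord_le {u v : N.V} {l : List N.A} (h : N.IsWalk u v l) {e : N.A}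
    (he : e ∈ l) : ord (N.head e) ≤ ord v := by
  induction l generalizing u with
  | nil => simp at he
  | cons a l ih =>
    rcases List.mem_cons.1 he with rfl | he
    · exact h.2.ord_le hord
    · exact ih h.2 he

theorem IsWalk.arc_trichotomy {u v : N.V} {l : List N.A} (h : N.IsWalk u v l) {e e' : N.A}
    (he : e ∈ l) (he' : e' ∈ l) :
    e = e' ∨ ord (N.head e) ≤ ord (N.tail e') ∨ ord (N.head e') ≤ ord (N.tail e) := by
  induction l generalizing u with
  | nil => simp at he
  | cons a l ih =>
    rcases List.mem_cons.1 he with h₁ | h₁ <;> rcases List.mem_cons.1 he' with h₂ | h₂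
    · exact Or.inl (h₁.trans h₂.symm)
    · exact Or.inr (Or.inl (h₁ ▸ h.2.ord_le_tail hord h₂))
    · exact Or.inr (Or.inr (h₂ ▸ h.2.ord_le_tail hord h₁))
    · exact ih h.2 h₁ h₂

theorem IsWalk.vert_ord_le_or {u v x : N.V} {l : List N.A} (h : N.IsWalk u v l) {e : N.A}
    (hx : x ∈ N.pathVerts l) (he : e ∈ l) :
    ord x ≤ ord (N.tail e) ∨ ord (N.head e) ≤ ord x := by
  obtain ⟨f, hf, rfl | rfl⟩ := hx <;> have h₁ := hord f <;> have h₂ := hord e <;>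
    rcases h.arc_trichotomy hord he hf with rfl | h' | h' <;> omega

theorem IsWalk.ord_le_of_mem {u v x : N.V} {l : List N.A} (h : N.IsWalk u v l)
    (hx : x ∈ N.pathVerts l) : ord u ≤ ord x := by
  obtain ⟨f, hf, rfl | rfl⟩ := hx <;> have h₁ := hord f <;> have := h.ord_le_tail hord hf <;> omega

theorem IsWalk.mem_ord_le {u v x : N.V} {l : List N.A} (h : N.IsWalk u v l)
    (hx : x ∈ N.pathVerts l) : ord x ≤ ord v := by
  obtain ⟨f, hf, rfl | rfl⟩ := hx <;> have h₁ := hord f <;> have := h.head_ord_le hord hf <;> omega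

theorem IsWalk.ord_injOn {u v x y : N.V} {l : List N.A} (h : N.IsWalk u v l)
    (hx : x ∈ N.pathVerts l) (hy : y ∈ N.pathVerts l) (hxy : ord x = ord y) : x = y := by
  rcases h.eq_or_exists_tail hx with hx' | ⟨e, he, hx'⟩ <;>
    rcases h.eq_or_exists_tail hy with hy' | ⟨f, hf, hy'⟩
  · rw [hx', hy']
  · have := h.head_ord_le hord hf
    have := hord f
    subst hx' hy'; omega
  · have := h.head_ord_le hord he
    have := hord e
    subst hx' hy'; omega
  · have := hord f
    have := hord e
    subst hx' hy'
    rcases h.arc_trichotomy hord he hf with rfl | h' | h'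
    · rfl
    · omega
    · omega

theorem IsWalk.exists_next {u v x y : N.V} {l : List N.A} (h : N.IsWalk u v l)
    (hx : x ∈ N.pathVerts l) (hy : y ∈ N.pathVerts l) (hxy : ord x < ord y) :
    ∃ e ∈ l, N.tail e = x ∧ ord (N.head e) ≤ ord y := by
  rcases h.eq_or_exists_tail hx with rfl | ⟨e, he, rfl⟩
  · have := h.mem_ord_le hord hy
    omega
  · refine ⟨e, he, rfl, ?_⟩
    have := h.vert_ord_le_or hord hy he
    omega

theorem IsWalk.exists_prev {u v x y : N.V} {l : List N.A} (h : N.IsWalk u v l)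
    (hx : x ∈ N.pathVerts l) (hy : y ∈ N.pathVerts l) (hxy : ord x < ord y) :
    ∃ e ∈ l, N.head e = y ∧ ord x ≤ ord (N.tail e) := by
  rcases h.eq_or_exists_head hy with rfl | ⟨e, he, rfl⟩
  · have := h.ord_le_of_mem hord hx
    omega
  · refine ⟨e, he, rfl, ?_⟩
    have := h.vert_ord_le_or hord hx he
    omega

theorem IsWalk.nodup {u v : N.V} {l : List N.A} (h : N.IsWalk u v l) : l.Nodup := by
  induction l generalizing u with
  | nil => simp
  | cons a l ih =>
    refine List.nodup_cons.2 ⟨fun ha => ?_, ih h.2⟩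
    have := h.2.ord_le_tail hord ha
    have := hord a
    omega

/-- A walk all of whose arcs lie on another walk with the same start is a prefix of it. -/
theorem IsWalk.prefix_of_subset {u v w : N.V} {l p : List N.A} (hl : N.IsWalk u v l)
    (hp : N.IsWalk u w p) (hsub : l ⊆ p) : l <+: p := by
  induction l generalizing u p with
  | nil => exact List.nil_prefix
  | cons a l ih =>
    cases p with
    | nil => simp at hsub
    | cons b p =>
      have hab : a = b := by
        rcases hp.arc_trichotomy hord (hsub List.mem_cons_self)
          (List.mem_cons_self (a := b) (l := p)) with h | h | h
        · exact h
        · have := hord a; have := congrArg ord (hl.1.trans hp.1.symm); omega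
        · have := hord b; have := congrArg ord (hl.1.trans hp.1.symm); omega
      subst hab
      refine List.cons_prefix_cons.2 ⟨rfl, ih hl.2 hp.2 fun e he => ?_⟩
      refine (List.mem_cons.1 (hsub (List.mem_cons_of_mem _ he))).resolve_left ?_
      rintro rfl
      have := hl.2.ord_le_tail hord he
      have := hord e
      omega

end Order

/-! ### Acyclicity of residual networks -/

/-- The contribution of the arc `e` to the net out-degree of the vertex `v`. -/
def netOut (N : KPairNetwork k) (v : N.V) (e : N.A) : ℤ :=
  (if N.tail e = v then 1 else 0) - (if N.head e = v then 1 else 0)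

theorem IsWalk.sum_netOut {u t : N.V} {l : List N.A} (h : N.IsWalk u t l) (v : N.V) :
    (l.map (N.netOut v)).sum = (if u = v then 1 else 0) - (if t = v then 1 else 0) := by
  induction l generalizing u with
  | nil => cases h; simp
  | cons a l ih =>
    rw [List.map_cons, List.sum_cons, ih h.2, netOut, h.1]
    ring

/-- An arc set whose net out-degree dominates a family of starting vertices away from `t`
contains arc-disjoint walks from these vertices to `t`. -/
theorem exists_disjoint_walks {ι : Type*} [Fintype ι] (t : N.V) (n : ℕ)
    (F : Finset N.A) (hF : F.card = n) (w : ι → N.V)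
    (hw : ∀ v, v ≠ t → ∑ i, (if w i = v then 1 else 0 : ℤ) ≤ ∑ e ∈ F, N.netOut v e) :
    ∃ Q : ι → List N.A, (∀ i, N.IsWalk (w i) t (Q i)) ∧ (∀ i, ∀ e ∈ Q i, e ∈ F) ∧
      ∀ i i', i ≠ i' → ∀ a ∈ Q i, a ∉ Q i' := by
  classical
  induction n generalizing F w with
  | zero =>
    refine ⟨fun _ => [], fun i => ?_, by simp, by simp⟩
    by_contra hi
    have h := hw (w i) hi
    rw [Finset.card_eq_zero.1 hF, Finset.sum_empty] at h
    have := Finset.single_le_sum (f := fun i' => (if w i' = w i then 1 else 0 : ℤ))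
      (fun i' _ => by positivity) (Finset.mem_univ i)
    simp only [if_true] at this
    omega
  | succ n ih =>
    by_cases hall : ∀ i, w i = t
    · exact ⟨fun _ => [], hall, by simp, by simp⟩
    push Not at hall
    obtain ⟨i, hi⟩ := hall
    obtain ⟨e, heF, he⟩ : ∃ e ∈ F, N.tail e = w i := by
      by_contra! hne
      have h := hw (w i) hi
      have h₁ := Finset.single_le_sum (f := fun i' => (if w i' = w i then 1 else 0 : ℤ))
        (fun i' _ => by positivity) (Finset.mem_univ i)
      have h₂ : ∑ e ∈ F, N.netOut (w i) e ≤ 0 := by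
        refine Finset.sum_nonpos fun e he => ?_
        rw [netOut, if_neg (hne e he)]
        split_ifs <;> simp
      simp only [if_true] at h₁
      omega
    obtain ⟨Q, hQ, hQF, hQd⟩ := ih (F.erase e) (by rw [Finset.card_erase_of_mem heF, hF]; rfl)
      (Function.update w i (N.head e)) fun v hv => by
        have h := hw v hv
        rw [← Finset.add_sum_erase F _ heF] at h
        rw [← Finset.add_sum_erase _ _ (Finset.mem_univ i)] at h ⊢
        have hrest : ∑ x ∈ Finset.univ.erase i,
            (if Function.update w i (N.head e) x = v then 1 else 0 : ℤ) =
            ∑ x ∈ Finset.univ.erase i, (if w x = v then 1 else 0 : ℤ) :=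
          Finset.sum_congr rfl fun x hx => by
            rw [Function.update_of_ne (Finset.ne_of_mem_erase hx)]
        rw [hrest, Function.update_self]
        rw [netOut, he] at h
        linarith
    have hmem : ∀ i', ∀ a ∈ Function.update Q i (e :: Q i) i', a ∈ Q i' ∨ (i' = i ∧ a = e) := by
      intro i' a ha
      by_cases h : i' = i
      · subst h
        rw [Function.update_self] at ha
        rcases List.mem_cons.1 ha with rfl | ha
        · exact Or.inr ⟨rfl, rfl⟩
        · exact Or.inl ha
      · rw [Function.update_of_ne h] at ha
        exact Or.inl ha
    refine ⟨Function.update Q i (e :: Q i), fun i' => ?_, fun i' a ha => ?_,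
      fun i₁ i₂ hne a ha₁ ha₂ => ?_⟩
    · by_cases h : i' = i
      · subst h
        rw [Function.update_self]
        have := hQ i'
        rw [Function.update_self] at this
        exact ⟨he, this⟩
      · have := hQ i'
        rwa [Function.update_of_ne h] at this ⊢
    · rcases hmem i' a ha with h | ⟨-, rfl⟩
      · exact Finset.mem_of_mem_erase (hQF i' a h)
      · exact heF
    · rcases hmem i₁ a ha₁ with h₁ | ⟨h₁, rfl⟩ <;> rcases hmem i₂ a ha₂ with h₂ | ⟨h₂, h₂'⟩
      · exact hQd i₁ i₂ hne a h₁ h₂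
      · exact Finset.ne_of_mem_erase (hQF i₁ a h₁) h₂'
      · exact Finset.ne_of_mem_erase (hQF i₂ a h₂) rfl
      · exact hne (h₁.trans h₂.symm)

/-- A nonempty finite family of arcs in which every arc has a successor contains a nonempty
balanced subfamily. -/
theorem exists_balanced {α β : Type*} [Fintype α] [DecidableEq α] [DecidableEq β]
    (s t : α → β) (S : Set α) (hS : S.Nonempty) (hnext : ∀ a ∈ S, ∃ b ∈ S, s b = t a) :
    ∃ C : Finset α, C.Nonempty ∧
      ∀ v, ∑ a ∈ C, (if s a = v then 1 else 0 : ℤ) = ∑ a ∈ C, (if t a = v then 1 else 0 : ℤ) := by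
  classical
  obtain ⟨a₀, ha₀⟩ := hS
  have hex : ∀ a, ∃ b, a ∈ S → b ∈ S ∧ s b = t a := fun a => by
    by_cases ha : a ∈ S
    · obtain ⟨b, hb⟩ := hnext a ha
      exact ⟨b, fun _ => hb⟩
    · exact ⟨a, fun h => absurd h ha⟩
  choose f hf using hex
  have hmaps : Set.MapsTo f S S := fun a ha => (hf a ha).1
  obtain ⟨m, n, hmn, hne⟩ := Finite.exists_ne_map_eq_of_infinite fun n : ℕ => f^[n] a₀
  have hper : ∃ b ∈ S, b ∈ Function.periodicPts f := by
    wlog h : m < n generalizing m n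
    · exact this n m hmn.symm hne.symm (by omega)
    refine ⟨f^[m] a₀, hmaps.iterate m ha₀,
      Function.mk_mem_periodicPts (n := n - m) (by omega) ?_⟩
    change f^[n - m] (f^[m] a₀) = f^[m] a₀
    rw [← Function.iterate_add_apply, Nat.sub_add_cancel h.le]
    exact hne.symm
  obtain ⟨b, hbS, hb⟩ := hper
  have hbij := Function.bijOn_periodicPts f
  refine ⟨Finset.univ.filter fun a => a ∈ S ∧ a ∈ Function.periodicPts f, ⟨b, by simp [hbS, hb]⟩,
    fun v => ?_⟩
  refine (Finset.sum_bij (fun a _ => f a) ?_ ?_ ?_ ?_).symm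
  · intro a ha
    simp only [Finset.mem_filter, Finset.mem_univ, true_and] at ha ⊢
    exact ⟨hmaps ha.1, hbij.mapsTo ha.2⟩
  · intro a ha c hc hac
    simp only [Finset.mem_filter, Finset.mem_univ, true_and] at ha hc
    exact hbij.injOn ha.2 hc.2 hac
  · intro c hc
    simp only [Finset.mem_filter, Finset.mem_univ, true_and] at hc
    obtain ⟨n, hn, hcn⟩ := Function.mem_periodicPts.1 hc.2
    refine ⟨f^[n - 1] c, ?_, ?_⟩
    · simp only [Finset.mem_filter, Finset.mem_univ, true_and]
      exact ⟨hmaps.iterate _ hc.1, hbij.mapsTo.iterate _ hc.2⟩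
    · rw [← Function.iterate_succ_apply' f, Nat.succ_eq_add_one, Nat.sub_add_cancel hn]
      exact hcn
  · intro a ha
    simp only [Finset.mem_filter, Finset.mem_univ, true_and] at ha
    rw [(hf a ha.1).2]

/-- `y` is the head of an arc with tail `x` in the `j`-th residual network. -/
def RStep (N : KPairNetwork k) (P : Fin k → Fin k → List N.A) (j : Fin k) (x y : N.V) : Prop :=
  ∃ e, N.rtail P j e = x ∧ N.rhead P j e = y

variable {P : Fin k → Fin k → List N.A}

theorem IsStrongSystem.isWalk (h : N.IsStrongSystem P) (i j : Fin k) :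
    N.IsWalk (N.src i) (N.snk j) (P i j) := (isPathFrom_iff.1 (h.1 i j)).2

theorem IsStrongSystem.ne_nil (h : N.IsStrongSystem P) (i j : Fin k) : P i j ≠ [] :=
  (h.1 i j).1

theorem IsStrongSystem.src_ne_snk (h : N.IsStrongSystem P) (i j : Fin k) :
    N.src i ≠ N.snk j := fun he =>
  N.src_no_in i _ (((h.1 i j).2.2.2 _ (List.getLast?_eq_getLast_of_ne_nil (h.ne_nil i j))).trans
    he.symm)

theorem IsStrongSystem.sum_netOut (hP : N.IsStrongSystem P) (j : Fin k) (F : Finset N.A)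
    (hF : ∀ e, e ∈ F ↔ ∃ i, e ∈ P i j) (v : N.V) (hv : v ≠ N.snk j) :
    ∑ e ∈ F, N.netOut v e = ∑ i, (if N.src i = v then 1 else 0 : ℤ) := by
  obtain ⟨ord, hord⟩ := N.acyclic
  have hFU : F = Finset.univ.biUnion fun i => (P i j).toFinset := by
    ext e; simp [hF]
  rw [hFU, Finset.sum_biUnion]
  · refine Finset.sum_congr rfl fun i _ => ?_
    rw [List.sum_toFinset _ ((hP.isWalk i j).nodup hord), (hP.isWalk i j).sum_netOut,
      if_neg hv.symm, sub_zero]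
  · intro i _ i' _ hne
    rw [Function.onFun, Finset.disjoint_left]
    intro a ha ha'
    exact hP.2 j i i' hne a (by simpa using ha) (by simpa using ha')

/-- The residual networks of a stable system are acyclic. -/
theorem IsStableSystem.not_transGen_rStep (hP : N.IsStableSystem P) (j : Fin k) (v : N.V) :
    ¬ Relation.TransGen (N.RStep P j) v v := by
  classical
  intro hv
  obtain ⟨ord, hord⟩ := N.acyclic
  obtain ⟨C, ⟨c, hc⟩, hC⟩ := exists_balanced (N.rtail P j) (N.rhead P j)
    {e | Relation.TransGen (N.RStep P j) (N.rhead P j e) v}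
    (by
      obtain ⟨y, ⟨e, he, rfl⟩, hy⟩ := Relation.TransGen.head'_iff.1 hv
      exact ⟨e, Relation.TransGen.trans_right hy hv⟩)
    (by
      intro e he
      obtain ⟨y, ⟨f, hf, rfl⟩, hy⟩ := Relation.TransGen.head'_iff.1 he
      exact ⟨f, Relation.TransGen.trans_right hy hv, hf⟩)
  set F : Finset N.A := Finset.univ.filter fun e => ∃ i, e ∈ P i j with hF
  have hmemF : ∀ e, e ∈ F ↔ ∃ i, e ∈ P i j := fun e => by simp [hF]
  have hsum : ∀ v, ∑ e ∈ (F \ C) ∪ (C \ F), N.netOut v e = ∑ e ∈ F, N.netOut v e := by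
    intro v
    have h₁ : ∑ e ∈ C, (if e ∈ F then -N.netOut v e else N.netOut v e) = 0 := by
      rw [← sub_eq_zero.2 (hC v), ← Finset.sum_sub_distrib]
      refine Finset.sum_congr rfl fun e _ => ?_
      simp only [rtail, rhead, netOut, hmemF]
      split_ifs <;> simp
    have h₂ : ∑ e ∈ C, (if e ∈ F then -N.netOut v e else N.netOut v e) =
        ∑ e ∈ C \ F, N.netOut v e - ∑ e ∈ C ∩ F, N.netOut v e := by
      rw [← Finset.sum_sdiff (Finset.inter_subset_left : C ∩ F ⊆ C), Finset.sdiff_inter_self_left,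
        sub_eq_add_neg, ← Finset.sum_neg_distrib]
      congr 1
      · exact Finset.sum_congr rfl fun e he => if_neg (Finset.mem_sdiff.1 he).2
      · exact Finset.sum_congr rfl fun e he => if_pos (Finset.mem_inter.1 he).2
    have h₃ : ∑ e ∈ F, N.netOut v e = ∑ e ∈ F \ C, N.netOut v e + ∑ e ∈ C ∩ F, N.netOut v e := by
      rw [← Finset.sum_sdiff (Finset.inter_subset_left : F ∩ C ⊆ F), Finset.sdiff_inter_self_left,
        Finset.inter_comm]
    rw [Finset.sum_union (Finset.disjoint_left.2 fun e he he' =>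
      (Finset.mem_sdiff.1 he).2 (Finset.mem_sdiff.1 he').1), h₃]
    linarith
  obtain ⟨Q, hQ, hQF, hQd⟩ := exists_disjoint_walks (N.snk j) _ ((F \ C) ∪ (C \ F)) rfl N.src
    fun v hv => by rw [hsum, hP.1.sum_netOut j F hmemF v hv]
  have hQP := hP.2 j Q (fun i => isPathFrom_iff.2 ⟨fun h => by
    have := hQ i
    rw [h] at this
    exact hP.1.src_ne_snk i j this, hQ i⟩) fun i i' hne a ha => hQd i i' hne a ha
  have hCF : ∀ e ∈ C, ¬ ∃ i, e ∈ P i j := by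
    rintro e he ⟨i, hi⟩
    have heF := (hmemF e).2 ⟨i, hi⟩
    rw [← hQP i] at hi
    have := hQF i e hi
    simp [he, heF] at this
  obtain ⟨e, he, hmax⟩ := Finset.exists_max_image C (fun e => ord (N.head e)) ⟨c, hc⟩
  have hpos : 0 < ∑ a ∈ C, (if N.rhead P j a = N.head e then 1 else 0 : ℤ) :=
    Finset.sum_pos' (fun _ _ => by positivity) ⟨e, he, by rw [rhead, if_neg (hCF e he)]; simp⟩
  rw [← hC] at hpos
  obtain ⟨f, hf, hf'⟩ := Finset.exists_ne_zero_of_sum_ne_zero hpos.ne'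
  have hfe : N.tail f = N.head e := by
    by_contra h
    rw [rtail, if_neg (hCF f hf), if_neg h] at hf'
    exact hf' rfl
  have h₁ := hmax f hf
  have h₂ := hord f
  rw [hfe] at h₂
  omega

/-! ### Vertices of a stable system -/

theorem IsStrongSystem.src_mem (hP : N.IsStrongSystem P) (i j : Fin k) :
    N.src i ∈ N.pathVerts (P i j) := by
  have h := hP.isWalk i j
  have hne := hP.ne_nil i j
  revert h hne
  cases P i j with
  | nil => simp
  | cons a l => exact fun h _ => ⟨a, by simp, Or.inl h.1.symm⟩

theorem IsStrongSystem.eq_of_src_mem (hP : N.IsStrongSystem P) {i i' j : Fin k}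
    (h : N.src i ∈ N.pathVerts (P i' j)) : i' = i := by
  rcases (hP.isWalk i' j).eq_or_exists_head h with h | ⟨e, -, he⟩
  · exact (N.src_inj h).symm
  · exact absurd he (N.src_no_in i e)

theorem IsStrongSystem.eq_of_snk_mem (hP : N.IsStrongSystem P) {i j j' : Fin k}
    (h : N.snk j ∈ N.pathVerts (P i j')) : j = j' := by
  rcases (hP.isWalk i j').eq_or_exists_tail h with h | ⟨e, -, he⟩
  · exact N.snk_inj h
  · exact absurd he (N.snk_no_out j e)

theorem IsStableSystem.eq_snk_of_mem (hP : N.IsStableSystem P) {a b j : Fin k} (hab : a ≠ b)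
    {x : N.V} (ha : x ∈ N.pathVerts (P a j)) (hb : x ∈ N.pathVerts (P b j)) : x = N.snk j := by
  classical
  by_contra hx
  obtain ⟨ord, hord⟩ := N.acyclic
  have hdab := hP.1.2 j a b hab
  have hna := (hP.1.isWalk a j).nodup hord
  have hnb := (hP.1.isWalk b j).nodup hord
  obtain ⟨l₁, l₂, hl, hl₁, hl₂⟩ := (hP.1.isWalk a j).exists_append ha
  obtain ⟨m₁, m₂, hm, hm₁, hm₂⟩ := (hP.1.isWalk b j).exists_append hb
  rw [hl] at hna hdab
  rw [hm] at hnb hdab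
  have hla : ∀ c, c ≠ a → ∀ e ∈ P c j, e ∉ l₁ ++ l₂ := fun c hc e he =>
    hl ▸ hP.1.2 j c a hc e he
  have hmb : ∀ c, c ≠ b → ∀ e ∈ P c j, e ∉ m₁ ++ m₂ := fun c hc e he =>
    hm ▸ hP.1.2 j c b hc e he
  have hQ := hP.2 j (fun i => if i = a then l₁ ++ m₂ else if i = b then m₁ ++ l₂ else P i j)
    (fun i => by
      refine isPathFrom_iff.2 (and_iff_right_of_imp (fun h he => ?_) |>.2 ?_)
      · rw [he] at h
        exact hP.1.src_ne_snk i j h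
      · split_ifs with h₁ h₂
        · exact h₁ ▸ hl₁.append hm₂
        · exact h₂ ▸ hm₁.append hl₂
        · exact hP.1.isWalk i j)
    (fun i i' hne e he he' => by
      have hout := hP.1.2 j i i' hne e
      have h₁ := hla i
      have h₂ := hla i'
      have h₃ := hmb i
      have h₄ := hmb i'
      rw [List.nodup_append] at hna hnb
      grind)
  have h := hQ a
  simp only [if_true, hl, List.append_cancel_left_eq] at h
  subst h
  cases m₂ with
  | nil => exact hx hl₂
  | cons e m => exact hdab e (by simp) (by simp)

section Order

variable {ord : N.V → ℕ} (hord : ∀ a : N.A, ord (N.tail a) < ord (N.head a))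
include hord

theorem IsStableSystem.transGen_rev (hP : N.IsStableSystem P) {a j : Fin k} {x y : N.V}
    (hx : x ∈ N.pathVerts (P a j)) (hy : y ∈ N.pathVerts (P a j)) (hxy : ord x < ord y) :
    Relation.TransGen (N.RStep P j) y x := by
  induction h : ord y - ord x using Nat.strong_induction_on generalizing x with
  | _ n ih =>
    obtain ⟨e, he, rfl, hle⟩ := (hP.1.isWalk a j).exists_next hord hx hy hxy
    have hstep : N.RStep P j (N.head e) (N.tail e) :=
      ⟨e, by rw [rtail, if_pos ⟨a, he⟩], by rw [rhead, if_pos ⟨a, he⟩]⟩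
    have := hord e
    rcases hle.eq_or_lt with heq | hlt
    · rw [← (hP.1.isWalk a j).ord_injOn hord (head_mem_pathVerts he) hy heq]
      exact .single hstep
    · exact (ih _ (by omega) (head_mem_pathVerts he) hlt rfl).tail hstep

theorem transGen_of_forall_not_isPArc {u v x y : N.V} {q : List N.A} {j : Fin k}
    (hq : N.IsWalk u v q) (hx : x ∈ N.pathVerts q) (hy : y ∈ N.pathVerts q)
    (hxy : ord x < ord y)
    (hfree : ∀ e ∈ q, ord x ≤ ord (N.tail e) → ord (N.head e) ≤ ord y → ¬ N.isPArc P j e) :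
    Relation.TransGen (N.RStep P j) x y := by
  induction h : ord y - ord x using Nat.strong_induction_on generalizing x with
  | _ n ih =>
    obtain ⟨e, he, rfl, hle⟩ := hq.exists_next hord hx hy hxy
    have hnot : ¬ ∃ i, e ∈ P i j := hfree e he le_rfl hle
    have hstep : N.RStep P j (N.tail e) (N.head e) :=
      ⟨e, by rw [rtail, if_neg hnot], by rw [rhead, if_neg hnot]⟩
    have := hord e
    rcases hle.eq_or_lt with heq | hlt
    · rw [← hq.ord_injOn hord (head_mem_pathVerts he) hy heq]
      exact .single hstep
    · exact .head hstep (ih _ (by omega) (head_mem_pathVerts he) hlt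
        (fun f hf h₁ h₂ => hfree f hf (by omega) h₂) rfl)

end Order

/-! ### Branch points -/

/-- The lists of arcs `p` and `q` coincide between their common vertices `u` and `x`. -/
def AgreeBetween (N : KPairNetwork k) (ord : N.V → ℕ) (p q : List N.A) (u x : N.V) : Prop :=
  x ∈ N.pathVerts p ∧ x ∈ N.pathVerts q ∧ ord u ≤ ord x ∧
    ∀ e, ord u ≤ ord (N.tail e) → ord (N.head e) ≤ ord x → (e ∈ p ↔ e ∈ q)

/-- `x` is the last vertex up to which `p` and `q` coincide from `u` on. -/
def IsBranch (N : KPairNetwork k) (ord : N.V → ℕ) (p q : List N.A) (u x : N.V) : Prop :=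
  N.AgreeBetween ord p q u x ∧ ∀ y, N.AgreeBetween ord p q u y → ord y ≤ ord x

theorem AgreeBetween.symm {ord : N.V → ℕ} {p q : List N.A} {u x : N.V}
    (h : N.AgreeBetween ord p q u x) : N.AgreeBetween ord q p u x :=
  ⟨h.2.1, h.1, h.2.2.1, fun e h₁ h₂ => (h.2.2.2 e h₁ h₂).symm⟩

theorem IsBranch.symm {ord : N.V → ℕ} {p q : List N.A} {u x : N.V}
    (h : N.IsBranch ord p q u x) : N.IsBranch ord q p u x :=
  ⟨h.1.symm, fun y hy => h.2 y hy.symm⟩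

section Order

variable {ord : N.V → ℕ} (hord : ∀ a : N.A, ord (N.tail a) < ord (N.head a))
include hord

theorem exists_isBranch {p q : List N.A} {u : N.V} (hp : u ∈ N.pathVerts p)
    (hq : u ∈ N.pathVerts q) : ∃ x, N.IsBranch ord p q u x := by
  have huu : N.AgreeBetween ord p q u u :=
    ⟨hp, hq, le_rfl, fun e h₁ h₂ => absurd (hord e) (by omega)⟩
  obtain ⟨x, hx, hmax⟩ := Set.exists_max_image {x | N.AgreeBetween ord p q u x} ord
    (Set.toFinite _) ⟨u, huu⟩
  exact ⟨x, hx, hmax⟩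

theorem AgreeBetween.mem {p q : List N.A} {s t u x y : N.V} (h : N.AgreeBetween ord p q u x)
    (hp : N.IsWalk s t p) (hup : u ∈ N.pathVerts p) (huq : u ∈ N.pathVerts q)
    (hy : y ∈ N.pathVerts p) (huy : ord u ≤ ord y) (hyx : ord y ≤ ord x) :
    y ∈ N.pathVerts q := by
  rcases huy.eq_or_lt with heq | hlt
  · rwa [← hp.ord_injOn hord hup hy heq]
  · obtain ⟨e, he, rfl, hle⟩ := hp.exists_prev hord hup hy hlt
    exact head_mem_pathVerts ((h.2.2.2 e hle hyx).1 he)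

/-- If `q` meets the paths towards the sink `j` after its branch point `x` with `P a j`, then the
residual network `N_j` leads from `x` to a vertex of `q` on another of these paths. -/
theorem IsStableSystem.exists_first_hit (hP : N.IsStableSystem P) {a b j m : Fin k} (hmj : m ≠ j)
    {u x w : N.V} (hx : N.IsBranch ord (P a j) (P b m) u x) {c : Fin k}
    (hw : w ∈ N.pathVerts (P b m)) (hwc : w ∈ N.pathVerts (P c j)) (hxw : ord x < ord w) :
    ∃ d c, c ≠ a ∧ d ∈ N.pathVerts (P b m) ∧ d ∈ N.pathVerts (P c j) ∧ ord x < ord d ∧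
      Relation.TransGen (N.RStep P j) x d := by
  obtain ⟨d, ⟨hdq, ⟨c', hdc⟩, hxd⟩, hmin⟩ := Set.exists_min_image
    {d | d ∈ N.pathVerts (P b m) ∧ (∃ c, d ∈ N.pathVerts (P c j)) ∧ ord x < ord d} ord
    (Set.toFinite _) ⟨w, hw, ⟨c, hwc⟩, hxw⟩
  have hwp := hP.1.isWalk a j
  have hwq := hP.1.isWalk b m
  have hx1 := hx.1.1
  have hx2 := hx.1.2.1
  have hx3 := hx.1.2.2.1
  have hxj : x ≠ N.snk j := by
    rintro rfl
    exact hmj (hP.1.eq_of_snk_mem hx2).symm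
  have hreach : Relation.TransGen (N.RStep P j) x d := by
    refine transGen_of_forall_not_isPArc hord hwq hx2 hdq hxd ?_
    rintro e heq he1 he2 ⟨c'', hec⟩
    have hlt := hord e
    have hhd : ord (N.head e) = ord d :=
      le_antisymm he2 (hmin _ ⟨head_mem_pathVerts heq, ⟨c'', head_mem_pathVerts hec⟩, by omega⟩)
    have htx : N.tail e = x := by
      refine hwq.ord_injOn hord (tail_mem_pathVerts heq) hx2 ?_
      by_contra hne
      have := hmin _ ⟨tail_mem_pathVerts heq, ⟨c'', tail_mem_pathVerts hec⟩, by omega⟩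
      omega
    have hca : c'' = a := by
      by_contra hne
      exact hxj (hP.eq_snk_of_mem hne (htx ▸ tail_mem_pathVerts hec) hx1)
    subst hca
    have := hx.2 (N.head e) ⟨head_mem_pathVerts hec, head_mem_pathVerts heq, by omega, ?_⟩
    · omega
    · intro f hf1 hf2
      constructor
      · intro hf
        rcases hwp.arc_trichotomy hord hf hec with rfl | h | h
        · exact heq
        · exact (hx.1.2.2.2 f hf1 (htx ▸ h)).1 hf
        · have := hord f; omega
      · intro hf
        rcases hwq.arc_trichotomy hord hf heq with rfl | h | h
        · exact hec
        · exact (hx.1.2.2.2 f hf1 (htx ▸ h)).2 hf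
        · have := hord f; omega
  refine ⟨d, c', ?_, hdq, hdc, hxd, hreach⟩
  rintro rfl
  exact hP.not_transGen_rStep j x (hreach.trans (hP.transGen_rev hord hx1 hdc hxd))

end Order

/-! ### Longest common segments -/

theorem SegOn.segVerts_subset {s : N.V × List N.A} {p : List N.A} (h : N.SegOn s p) :
    N.segVerts s ⊆ N.pathVerts p := by
  rintro x (rfl | hx)
  · exact h.2
  · exact pathVerts_mono h.1.subset hx

theorem exists_isLCS {p q : List N.A} {w : N.V} (hp : w ∈ N.pathVerts p)
    (hq : w ∈ N.pathVerts q) : ∃ s, N.IsLCS {p, q} s ∧ w ∈ N.segVerts s := by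
  classical
  let good (n : ℕ) : Prop := ∃ s : N.V × List N.A, s.2.length = n ∧ N.IsSeg s ∧ N.SegOn s p ∧
    N.SegOn s q ∧ w ∈ N.segVerts s
  have h0 : good 0 := ⟨(w, []), rfl, by simp [IsSeg, List.Chain'], ⟨List.nil_infix, hp⟩,
    ⟨List.nil_infix, hq⟩, Or.inl rfl⟩
  obtain ⟨s, hn, hs, hsp, hsq, hw⟩ := Nat.findGreatest_spec (Nat.zero_le p.length) h0
  refine ⟨s, ⟨hs, by simp [hsp, hsq], fun s' hs' hle hne => ?_⟩, hw⟩
  by_contra! hon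
  simp only [Set.mem_insert_iff, Set.mem_singleton_iff, forall_eq_or_imp, forall_eq] at hon
  have hw' : w ∈ N.segVerts s' := by
    rcases hw with rfl | hw
    · exact hle.2
    · exact Or.inr (pathVerts_mono hle.1.subset hw)
  have hlen := Nat.le_findGreatest (hon.1.1.length_le)
    (show good s'.2.length from ⟨s', rfl, hs', hon.1, hon.2, hw'⟩)
  rw [← hn] at hlen
  have h2 : s.2 = s'.2 := hle.1.eq_of_length_le hlen
  refine hne (Prod.ext ?_ h2.symm)
  by_cases hnil : s'.2 = []
  · have := hle.2
    rw [segVerts, hnil] at this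
    rcases this with h | ⟨e, he, -⟩
    · exact h.symm
    · simp at he
  · obtain ⟨e, l, hel⟩ := List.exists_cons_of_ne_nil hnil
    rw [← hs'.2 e (by simp [hel]), ← hs.2 e (by simp [h2, hel])]

theorem IsWalk.exists_of_append {u v : N.V} {l₁ l₂ : List N.A} (h : N.IsWalk u v (l₁ ++ l₂)) :
    ∃ x, N.IsWalk u x l₁ ∧ N.IsWalk x v l₂ := by
  induction l₁ generalizing u with
  | nil => exact ⟨u, rfl, h⟩
  | cons a l ih =>
    obtain ⟨x, hx, hx'⟩ := ih h.2
    exact ⟨x, ⟨h.1, hx⟩, hx'⟩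

section Order

variable {ord : N.V → ℕ} (hord : ∀ a : N.A, ord (N.tail a) < ord (N.head a))
include hord

theorem SegOn.mem_segVerts_of_ord_le {s : N.V × List N.A} {q : List N.A} {u v x y z : N.V}
    (h : N.SegOn s q) (hs : N.IsSeg s) (hq : N.IsWalk u v q) (hx : x ∈ N.segVerts s)
    (hz : z ∈ N.segVerts s) (hy : y ∈ N.pathVerts q) (hxy : ord x ≤ ord y) (hyz : ord y ≤ ord z) :
    y ∈ N.segVerts s := by
  have hxq := h.segVerts_subset hx
  have hzq := h.segVerts_subset hz
  by_cases hxy' : ord y = ord x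
  · rwa [hq.ord_injOn hord hy hxq hxy']
  by_cases hyz' : ord y = ord z
  · rwa [hq.ord_injOn hord hy hzq hyz']
  have hne : s.2 ≠ [] := by
    intro hnil
    rw [segVerts, hnil] at hx hz
    have : ∀ w ∈ insert s.1 (N.pathVerts []), w = s.1 := by
      rintro w (rfl | ⟨e, he, -⟩)
      · rfl
      · simp at he
    rw [this x hx] at hxy
    rw [this z hz] at hyz
    rw [this x hx] at hxy'
    omega
  have hseg : ∀ w ∈ N.segVerts s, w ∈ N.pathVerts s.2 := by
    rintro w (rfl | hw)
    · obtain ⟨e, l, hel⟩ := List.exists_cons_of_ne_nil hne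
      rw [← hs.2 e (by simp [hel])]
      exact tail_mem_pathVerts (by simp [hel])
    · exact hw
  obtain ⟨c, d, hcd⟩ := h.1
  rw [← hcd] at hq hy
  obtain ⟨r₂, hr, hd⟩ := hq.exists_of_append
  obtain ⟨r₁, hc, hm⟩ := hr.exists_of_append
  have hxm := hseg x hx
  have hzm := hseg z hz
  have h₁ := hm.ord_le_of_mem hord hxm
  have h₂ := hm.mem_ord_le hord hzm
  obtain ⟨e, he, hey⟩ := hy
  rcases List.mem_append.1 he with he | he
  · rcases List.mem_append.1 he with he | he
    · have := hc.mem_ord_le hord (x := y) ⟨e, he, hey⟩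
      omega
    · exact Or.inr ⟨e, he, hey⟩
  · have := hd.ord_le_of_mem hord (x := y) ⟨e, he, hey⟩
    omega

end Order

theorem lcsCount_comm (a b : Fin k) (p : List N.A) :
    N.lcsCount P a b p = N.lcsCount P b a p := by
  have : {s | N.IsPairLCSOn P a b p s} = {s | N.IsPairLCSOn P b a p s} := by
    ext s
    simp only [IsPairLCSOn, Set.mem_ofPred_eq]
    refine and_congr_left fun _ => ⟨?_, ?_⟩ <;> rintro ⟨i, i', h⟩ <;>
      exact ⟨i', i, Set.pair_comm _ _ ▸ h⟩
  rw [lcsCount, lcsCount, this]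

section Order

variable {ord : N.V → ℕ} (hord : ∀ a : N.A, ord (N.tail a) < ord (N.head a))
include hord

/-- A path with a single l.c.s. meets the paths towards the other sink only in an initial segment
of the path with the same source. -/
theorem IsStrongSystem.of_lcsCount_eq_one (hP : N.IsStrongSystem P) {a b c m : Fin k}
    (h : N.lcsCount P c m (P a c) = 1) {w : N.V} (hw : w ∈ N.pathVerts (P a c))
    (hwb : w ∈ N.pathVerts (P b m)) :
    b = a ∧ ∀ y ∈ N.pathVerts (P a m), ord y ≤ ord w → y ∈ N.pathVerts (P a c) := by
  obtain ⟨s, hs, hws⟩ := exists_isLCS hw hwb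
  obtain ⟨s', hs', hws'⟩ := exists_isLCS (hP.src_mem a c) (hP.src_mem a m)
  have hon : N.SegOn s (P a c) := hs.2.1 _ (by simp)
  have hon' : N.SegOn s' (P a c) := hs'.2.1 _ (by simp)
  have heq : s' = s := by
    have hsub := (Nat.card_eq_one_iff_unique.1 h).1
    exact congrArg Subtype.val (hsub.elim
      (⟨s', ⟨a, a, hs'⟩, hon'⟩ : {s | N.IsPairLCSOn P c m (P a c) s}) ⟨s, ⟨a, b, hs⟩, hon⟩)
  subst heq
  refine ⟨hP.eq_of_src_mem ((hs.2.1 _ (by simp) : N.SegOn s' (P b m)).segVerts_subset hws'),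
    fun y hy hyw => hon.segVerts_subset ?_⟩
  exact (hs'.2.1 _ (by simp) : N.SegOn s' (P a m)).mem_segVerts_of_ord_le hord hs.1
    (hP.isWalk a m) hws' hws hy ((hP.isWalk a m).ord_le_of_mem hord hy) hyw

/-- A path with several l.c.s.'s meets the paths towards the other sink after its branch point with
the path with the same source. -/
theorem IsStableSystem.exists_of_lcsCount_ne_one (hP : N.IsStableSystem P) {a m j : Fin k}
    (hmj : m ≠ j) (h : N.lcsCount P m j (P a m) ≠ 1) {x : N.V}
    (hx : N.IsBranch ord (P a j) (P a m) (N.src a) x) :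
    ∃ w c, w ∈ N.pathVerts (P a m) ∧ w ∈ N.pathVerts (P c j) ∧ ord x < ord w := by
  by_contra! hno
  apply h
  have hwp := hP.1.isWalk a j
  have hwq := hP.1.isWalk a m
  obtain ⟨q₁, q₂, hq, hq₁, hq₂⟩ := hwq.exists_append hx.1.2.1
  have hmem₁ : ∀ e ∈ P a m, ord (N.head e) ≤ ord x → e ∈ q₁ := by
    intro e he hle
    rw [hq] at he
    refine (List.mem_append.1 he).resolve_right fun he => ?_
    have := hq₂.ord_le_tail hord he
    have := hord e
    omega
  have hsub : q₁ ⊆ P a j := fun e he =>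
    (hx.1.2.2.2 e (hq₁.ord_le_tail hord he) (hq₁.head_ord_le hord he)).2 (by simp [hq, he])
  have hpre : q₁ <+: P a j := hq₁.prefix_of_subset hord hwp hsub
  have hSm : N.SegOn (N.src a, q₁) (P a m) :=
    ⟨(hq ▸ List.prefix_append q₁ q₂ : q₁ <+: P a m).isInfix, hP.1.src_mem a m⟩
  have hSj : N.SegOn (N.src a, q₁) (P a j) := ⟨hpre.isInfix, hP.1.src_mem a j⟩
  have huniq : ∀ s, N.IsPairLCSOn P m j (P a m) s → s = (N.src a, q₁) := by
    rintro s ⟨⟨a', b', hs⟩, hon⟩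
    have hon₁ : N.SegOn s (P a' m) := hs.2.1 _ (by simp)
    have hon₂ : N.SegOn s (P b' j) := hs.2.1 _ (by simp)
    have hord₁ := hno s.1 b' hon.2 hon₂.2
    have hs1j : s.1 ∈ N.pathVerts (P a j) :=
      hx.1.symm.mem hord hwq (hP.1.src_mem a m) (hP.1.src_mem a j) hon.2
        (hwq.ord_le_of_mem hord hon.2) hord₁
    have hb : b' = a := by
      by_contra hne
      have := hP.eq_snk_of_mem hne hon₂.2 hs1j
      have hmem := hon.2
      rw [this] at hmem
      exact hmj (hP.1.eq_of_snk_mem hmem).symm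
    have ha : a' = a := by
      by_contra hne
      have := hP.eq_snk_of_mem hne hon₁.2 hon.2
      rw [this] at hs1j
      exact hmj (hP.1.eq_of_snk_mem hs1j)
    subst hb
    subst ha
    by_contra hne
    have hle : N.SegLE s (N.src a', q₁) := by
      constructor
      · have hdisj : ∀ e ∈ s.2, e ∉ q₂ := by
          intro e he he₂
          have h₁ := hno _ a' (head_mem_pathVerts (hon₁.1.subset he))
            (head_mem_pathVerts (hon₂.1.subset he))
          have := hq₂.ord_le_tail hord he₂
          have := hord e
          omega
        by_cases hnil : s.2 = []
        · rw [hnil]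
          exact List.nil_infix
        obtain ⟨c, d, hcd⟩ := hon₁.1
        rw [hq] at hcd
        rcases List.append_eq_append_iff.1 hcd with ⟨r, hr, -⟩ | ⟨r, hr, hr'⟩
        · exact ⟨c, r, hr.symm⟩
        · have hlast : r = [] := by
            by_contra hr0
            rcases List.append_eq_append_iff.1 hr with ⟨t, ht, ht'⟩ | ⟨t, ht, ht'⟩
            · obtain ⟨e, he⟩ := List.exists_mem_of_ne_nil _ hr0
              exact hdisj e (by simp [ht', he]) (by simp [hr', he])
            · obtain ⟨e, he⟩ := List.exists_mem_of_ne_nil _ hnil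
              exact hdisj e he (by simp [hr', ht', he])
          subst hlast
          exact ⟨c, [], by simpa using hr⟩
      · rcases hwq.eq_or_exists_head hon.2 with h1 | ⟨e, he, h1⟩
        · exact Or.inl h1
        · exact Or.inr ⟨e, hmem₁ e he (h1 ▸ hord₁), Or.inr h1.symm⟩
    obtain ⟨p, hp, hnot⟩ := hs.2.2 _ hq₁.isSeg hle (Ne.symm hne)
    rcases hp with rfl | rfl
    · exact hnot hSm
    · exact hnot hSj
  obtain ⟨s, hs, -⟩ := exists_isLCS (hP.1.src_mem a m) (hP.1.src_mem a j)
  have hs' : N.IsPairLCSOn P m j (P a m) s := ⟨⟨a, a, hs⟩, hs.2.1 _ (by simp)⟩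
  exact Nat.card_eq_one_iff_unique.2
    ⟨⟨fun s t => Subtype.ext ((huniq _ s.2).trans (huniq _ t.2).symm)⟩, ⟨⟨s, hs'⟩⟩⟩

end Order

/-! ### The excluded configuration -/

theorem IsStableSystem.not_mem_of_ne (hP : N.IsStableSystem P)
    {a b c d m : Fin k} {v : N.V} (hab : a ≠ b) (hcm : m ≠ c) (hb : v ∈ N.pathVerts (P b m))
    (hd : v ∈ N.pathVerts (P d c)) : v ∉ N.pathVerts (P a m) := by
  intro ha
  obtain rfl := hP.eq_snk_of_mem hab ha hb
  exact hcm (hP.1.eq_of_snk_mem hd)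

/-- The configuration is impossible when the branch point of the two paths `P l l` and `P l j` is
the last one, in the topological order, of the three branch points considered. -/
theorem IsStableSystem.false_of_branch_le
    (hP : N.IsStableSystem P) {ord : N.V → ℕ} (hord : ∀ a : N.A, ord (N.tail a) < ord (N.head a))
    {i j l : Fin k} (hij : i ≠ j) (hil : i ≠ l) (hjl : j ≠ l) (hall : ∀ c, c = i ∨ c = j ∨ c = l)
    (h₁ : N.lcsCount P i j (P l i) = 1) (h₂ : N.lcsCount P i l (P l i) = 1)
    (h₃ : N.lcsCount P j l (P i j) = 1) (h₄ : N.lcsCount P j i (P j j) ≠ 1)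
    (h₅ : N.lcsCount P l j (P l l) ≠ 1) {v xi xj xl : N.V} (hvi : v ∈ N.pathVerts (P j i))
    (hvj : v ∈ N.pathVerts (P l j)) (hvl : v ∈ N.pathVerts (P i l))
    (hxi : N.IsBranch ord (P i i) (P i l) (N.src i) xi)
    (hxj : N.IsBranch ord (P j j) (P j i) (N.src j) xj)
    (hxl : N.IsBranch ord (P l l) (P l j) (N.src l) xl)
    (hil_le : ord xi ≤ ord xl) (hjl_le : ord xj ≤ ord xl) : False := by
  have hsrc := hP.1.src_mem
  have hw := hP.1.isWalk
  have hvi' := hP.not_mem_of_ne hij hij hvi hvj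
  have hvj' := hP.not_mem_of_ne hjl hjl hvj hvl
  have hvl' := hP.not_mem_of_ne hil.symm hil.symm hvl hvi
  have hxiv : ord xi < ord v := by
    by_contra! hle
    exact hvi' (hxi.1.symm.mem hord (hw i l) (hsrc i l) (hsrc i i) hvl
      ((hw i l).ord_le_of_mem hord hvl) hle)
  have hxlv : ord xl < ord v := by
    by_contra! hle
    exact hvl' (hxl.1.symm.mem hord (hw l j) (hsrc l j) (hsrc l l) hvj
      ((hw l j).ord_le_of_mem hord hvj) hle)
  -- The two residual walks towards the sink `i`, which would close up to a cycle.
  obtain ⟨u, huj, hul, hu⟩ : ∃ u, u ∈ N.pathVerts (P j j) ∧ u ∈ N.pathVerts (P i l) ∧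
      ord u ≤ ord xl := by
    obtain ⟨w, c, hwj, hwc, hxw⟩ := hP.exists_of_lcsCount_ne_one hord hij.symm h₄ hxj.symm
    obtain ⟨d, c, hcj, hdj, hdc, hxd, hRd⟩ :=
      hP.exists_first_hit hord hij.symm hxj.symm hwj hwc hxw
    obtain ⟨g, c', hci, hgl, hgc, hxg, hRg⟩ :=
      hP.exists_first_hit hord hil.symm hxi hvl hvi hxiv
    obtain rfl : c = i := by
      rcases hall c with h | rfl | rfl
      · exact h
      · exact absurd rfl hcj
      · exact absurd (hP.1.of_lcsCount_eq_one hord h₁ hdc hdj).1 hjl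
    obtain rfl : c' = j := by
      rcases hall c' with rfl | h | rfl
      · exact absurd rfl hci
      · exact h
      · exact absurd (hP.1.of_lcsCount_eq_one hord h₂ hgc hgl).1 hil
    rcases le_or_gt (ord d) (ord xi) with hd | hd
    · exact ⟨d, hdj, hxi.1.mem hord (hw _ _) (hsrc _ _) (hsrc _ _) hdc
        ((hw _ _).ord_le_of_mem hord hdc) hd, hd.trans hil_le⟩
    rcases le_or_gt (ord g) (ord xj) with hg | hg
    · exact ⟨g, hxj.1.symm.mem hord (hw _ _) (hsrc _ _) (hsrc _ _) hgc
        ((hw _ _).ord_le_of_mem hord hgc) hg, hgl, hg.trans hjl_le⟩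
    exact absurd (((hRd.trans (hP.transGen_rev hord hxi.1.1 hdc hd)).trans hRg).trans
      (hP.transGen_rev hord hxj.1.2.1 hgc hg)) (hP.not_transGen_rStep _ _)
  -- The residual cycle for the sink `j`.
  obtain ⟨w, c, hwl, hwc, hxw⟩ := hP.exists_of_lcsCount_ne_one hord hjl.symm h₅ hxl.symm
  obtain ⟨d, c, hcl, hdl, hdc, hxd, hRd⟩ :=
    hP.exists_first_hit hord hjl.symm hxl.symm hwl hwc hxw
  obtain rfl : c = j := by
    rcases hall c with rfl | h | rfl
    · exact absurd (hP.1.of_lcsCount_eq_one hord h₃ hdc hdl).1 hil.symm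
    · exact h
    · exact absurd rfl hcl
  obtain ⟨y, hy⟩ := exists_isBranch hord huj hul
  have hyv : ord y < ord v := by
    by_contra! hle
    exact hvj' (hy.1.symm.mem hord (hw _ _) hul huj hvl (by omega) hle)
  obtain ⟨g, c', hcj, hgl, hgc, hyg, hRg⟩ :=
    hP.exists_first_hit hord hjl.symm hy hvl hvj hyv
  obtain rfl : c' = l := by
    rcases hall c' with rfl | rfl | h
    · have hyc := (hP.1.of_lcsCount_eq_one hord h₃ hgc hgl).2 y hy.1.2.1 hyg.le
      exact absurd hy.1.1 (hP.not_mem_of_ne hcj.symm hjl hyc hy.1.2.1)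
    · exact absurd rfl hcj
    · exact h
  have hxg : ord xl < ord g := by
    by_contra! hle
    have hgl' := hxl.1.symm.mem hord (hw _ _) (hsrc _ _) (hsrc _ _) hgc
      ((hw _ _).ord_le_of_mem hord hgc) hle
    exact hP.not_mem_of_ne hil.symm hjl.symm hgl hgc hgl'
  have hyd : ord y < ord d := by
    by_contra! hle
    have hdl' := hy.1.mem hord (hw _ _) huj hul hdc (by omega) hle
    exact hP.not_mem_of_ne hil hjl.symm hdl hdc hdl'
  exact hP.not_transGen_rStep _ _ (((hRg.trans (hP.transGen_rev hord hxl.1.2.1 hgc hxg)).trans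
    hRd).trans (hP.transGen_rev hord hy.1.1 hdc hyd))

end KPairNetwork

/-- Theorem 7 of the paper: there is no stable 3-pair
network with pairwise distinct `i, j, l` such that `m_{i,j}^i = {l}`,
`m_{i,j}^j = {i}`, `m_{i,l}^i = {l}`, `m_{i,l}^l = {j}`, `m_{j,l}^j = {i}`,
`m_{j,l}^l = {j}`, and there exists an l.c.s. of
`{P_{s_j,t_i}, P_{s_l,t_j}, P_{s_i,t_l}}`. -/
theorem statement7 (N : KPairNetwork 3) (P : Fin 3 → Fin 3 → List N.A)
    (hP : N.IsStableSystem P)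
    (i j l : Fin 3) (hij : i ≠ j) (hil : i ≠ l) (hjl : j ≠ l) :
    ¬ ((N.mset P i j i = {l} ∧ N.mset P i j j = {i} ∧
        N.mset P i l i = {l} ∧ N.mset P i l l = {j} ∧
        N.mset P j l j = {i} ∧ N.mset P j l l = {j}) ∧
       ∃ s : N.V × List N.A, N.IsLCS {P j i, P l j, P i l} s) := by
  rintro ⟨⟨mij, mij', mil, mil', mjl, mjl'⟩, s, -, hs, -⟩
  obtain ⟨ord, hord⟩ := N.acyclic
  have count_eq {a b c d : Fin 3} (h : N.mset P a b c = {d}) : N.lcsCount P a b (P d c) = 1 := by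
    have : d ∈ N.mset P a b c := h ▸ rfl
    exact this
  have count_ne {a b c d e : Fin 3} (h : N.mset P a b c = {d}) (he : e ≠ d) :
      N.lcsCount P a b (P e c) ≠ 1 := by
    intro h'
    have : e ∈ N.mset P a b c := h'
    rw [h] at this
    exact he this
  have hsrc := hP.1.src_mem
  have hvi := (hs (P j i) (by simp)).2
  have hvj := (hs (P l j) (by simp)).2
  have hvl := (hs (P i l) (by simp)).2
  obtain ⟨xi, hxi⟩ := KPairNetwork.exists_isBranch hord (hsrc i i) (hsrc i l)
  obtain ⟨xj, hxj⟩ := KPairNetwork.exists_isBranch hord (hsrc j j) (hsrc j i)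
  obtain ⟨xl, hxl⟩ := KPairNetwork.exists_isBranch hord (hsrc l l) (hsrc l j)
  have hi := count_ne mil hil
  have hj := count_ne mij' hij.symm
  have hl := count_ne mjl' hjl.symm
  rw [KPairNetwork.lcsCount_comm] at hj hl
  have eqi := count_eq mij
  have eqi' := count_eq mil
  have eqj := count_eq mjl
  have eqj' := KPairNetwork.lcsCount_comm (N := N) i j _ ▸ count_eq mij'
  have eql := KPairNetwork.lcsCount_comm (N := N) i l _ ▸ count_eq mil'
  have eql' := KPairNetwork.lcsCount_comm (N := N) j l _ ▸ count_eq mjl'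
  have max_l := hP.false_of_branch_le hord hij hil hjl (by omega) eqi eqi' eqj hj hl hvi hvj hvl
    hxi hxj hxl
  have max_i := hP.false_of_branch_le hord hjl hij.symm hil.symm (by omega) eqj eqj' eql hl hi
    hvj hvl hvi hxj hxl hxi
  have max_j := hP.false_of_branch_le hord hil.symm hjl.symm hij (by omega) eql eql' eqi hi hj
    hvl hvi hvj hxl hxi hxj
  rcases le_total (ord xi) (ord xl) with h₁ | h₁
  · rcases le_total (ord xj) (ord xl) with h₂ | h₂
    · exact max_l h₁ h₂
    · exact max_j h₂ (h₁.trans h₂)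
  · rcases le_total (ord xj) (ord xi) with h₂ | h₂
    · exact max_i h₂ h₁
    · exact max_j (h₁.trans h₂) h₂
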